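/- arXiv:1712.00896 — 6 statements merged into one kernel-verified Lean document; each statement's English description precedes it below -/
import Mathlib

section
/- As linear operators on P, the operators satisfy the defining relations of the extended affine Lie algebra \widehat{gl_2(ℂ_q)}: for all i,j,k,l ∈ {1,2} and all u = (u₁,u₂), n = (n₁,n₂) ∈ ℤ², [E_{ij}(u), E_{kl}(n)] = δ_{jk} q^{u₂n₁} E_{il}(u+n) − δ_{il} q^{n₂u₁} E_{kj}(u+n); moreover [D₁, E_{ij}(n)] = n₁ E_{ij}(n), [D₂, E_{ij}(n)] = n₂ E_{ij}(n), and [D₁, D₂] = 0. (Here [A,B] = A∘B − B∘A.) -/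
open MvPolynomial

abbrev PP := MvPolynomial (ℤ × ℤ) ℂ

/-- `E21(n)` : multiplication by `x_n`. -/
noncomputable def E21P (n : ℤ × ℤ) (f : PP) : PP := X n * f

/-- `E22(n) = Σ_s q^{s₁n₂} x_{n+s} ∂_s` (locally finite sum). -/
noncomputable def E22P (q : ℂ) (n : ℤ × ℤ) (f : PP) : PP :=
  ∑ s ∈ f.vars, q ^ (s.1 * n.2) • (X (n + s) * pderiv s f)

/-- `E11(n) = δ_{n,0} μ id − Σ_s q^{s₂n₁} x_{n+s} ∂_s`. -/
noncomputable def E11P (q μ : ℂ) (n : ℤ × ℤ) (f : PP) : PP :=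
  (if n = 0 then μ • f else 0) - ∑ s ∈ f.vars, q ^ (s.2 * n.1) • (X (n + s) * pderiv s f)

/-- `E12(n) = q^{−n₁n₂} μ ∂_{−n} − Σ_{s,r} q^{n₂r₁+s₂n₁+s₂r₁} x_{n+s+r} ∂_s ∂_r`. -/
noncomputable def E12P (q μ : ℂ) (n : ℤ × ℤ) (f : PP) : PP :=
  q ^ (-(n.1 * n.2)) • μ • pderiv (-n) f -
    ∑ s ∈ f.vars, ∑ r ∈ f.vars,
      q ^ (n.2 * r.1 + s.2 * n.1 + s.2 * r.1) • (X (n + s + r) * pderiv s (pderiv r f))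

/-- `D1 = Σ_s s₁ x_s ∂_s`. -/
noncomputable def D1P (f : PP) : PP := ∑ s ∈ f.vars, (s.1 : ℂ) • (X s * pderiv s f)

/-- `D2 = Σ_s s₂ x_s ∂_s`. -/
noncomputable def D2P (f : PP) : PP := ∑ s ∈ f.vars, (s.2 : ℂ) • (X s * pderiv s f)

/-- `E_{ij}(n)`, `i,j ∈ {1,2}` (indices `0,1` in `Fin 2`). -/
noncomputable def EopP (q μ : ℂ) (i j : Fin 2) : (ℤ × ℤ) → PP → PP :=
  if i = 0 then (if j = 0 then E11P q μ else E12P q μ)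
  else (if j = 0 then E21P else E22P q)


namespace QuantumTorus

/-- A first order operator `∑ₛ gₛ ∂ₛ`, summed over the variables of its argument, is the
derivation sending `x_s` to `gₛ`. -/
theorem sum_vars_mul_pderiv (g : ℤ × ℤ → PP) (f : PP) :
    ∑ s ∈ f.vars, g s * pderiv s f = mkDerivation ℂ g f := by
  have hsum : ∀ a : PP, (∑ s ∈ f.vars, g s • pderiv s : Derivation ℂ PP PP) a =
      ∑ s ∈ f.vars, g s * pderiv s a := fun a => by
    rw [← Derivation.coeFnAddMonoidHom_apply, map_sum]
    simp [Finset.sum_apply]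
  have h : (∑ s ∈ f.vars, g s • pderiv s : Derivation ℂ PP PP) f = mkDerivation ℂ g f := by
    refine derivation_eq_of_forall_mem_vars fun i hi => ?_
    simp [hsum, pderiv_X, Pi.single_apply, hi]
  simpa [hsum] using h

/-- The second order operator `∑ₛᵣ gₛᵣ ∂ₛ∂ᵣ`. -/
noncomputable def secondOrder (g : ℤ × ℤ → ℤ × ℤ → PP) (f : PP) : PP :=
  ∑ s ∈ f.vars, ∑ r ∈ f.vars, g s r * pderiv s (pderiv r f)

theorem pderiv_pderiv_comm (s r : ℤ × ℤ) (f : PP) :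
    pderiv s (pderiv r f) = pderiv r (pderiv s f) := by
  have h : ⁅(pderiv s : Derivation ℂ PP PP), (pderiv r : Derivation ℂ PP PP)⁆ = 0 := by
    refine derivation_ext fun i => ?_
    simp [Derivation.commutator_apply, pderiv_X, Pi.single_apply, apply_ite]
  have := congrArg (fun D => D f) h
  simpa [Derivation.commutator_apply, sub_eq_zero] using this

theorem secondOrder_eq_of_subset (g : ℤ × ℤ → ℤ × ℤ → PP) {f : PP} {S : Finset (ℤ × ℤ)}
    (h : f.vars ⊆ S) :
    secondOrder g f = ∑ s ∈ S, ∑ r ∈ S, g s r * pderiv s (pderiv r f) := by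
  have h0 : ∀ r, r ∉ f.vars → pderiv r f = 0 := fun r hr => pderiv_eq_zero_of_notMem_vars hr
  rw [secondOrder]
  refine (Finset.sum_subset h fun s _ hs => ?_).trans (Finset.sum_congr rfl fun s _ => ?_)
  · exact Finset.sum_eq_zero fun r _ => by rw [pderiv_pderiv_comm, h0 s hs, map_zero, mul_zero]
  · exact Finset.sum_subset h fun r _ hr => by rw [h0 r hr, map_zero, mul_zero]

theorem secondOrder_add (g : ℤ × ℤ → ℤ × ℤ → PP) (f f' : PP) :
    secondOrder g (f + f') = secondOrder g f + secondOrder g f' := by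
  classical
  rw [secondOrder_eq_of_subset g (S := f.vars ∪ f'.vars) (vars_add_subset f f'),
    secondOrder_eq_of_subset g (f := f) (S := f.vars ∪ f'.vars) Finset.subset_union_left,
    secondOrder_eq_of_subset g (f := f') (S := f.vars ∪ f'.vars) Finset.subset_union_right]
  simp [mul_add, Finset.sum_add_distrib]

theorem secondOrder_smul (g : ℤ × ℤ → ℤ × ℤ → PP) (c : ℂ) (f : PP) :
    secondOrder g (c • f) = c • secondOrder g f := by
  classical
  rw [secondOrder_eq_of_subset g (f := c • f) (S := (c • f).vars ∪ f.vars)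
      Finset.subset_union_left,
    secondOrder_eq_of_subset g (f := f) (S := (c • f).vars ∪ f.vars) Finset.subset_union_right]
  simp [Finset.smul_sum]

theorem secondOrder_X_mul (g : ℤ × ℤ → ℤ × ℤ → PP) (m : ℤ × ℤ) (f : PP) :
    secondOrder g (X m * f) = X m * secondOrder g f +
      (mkDerivation ℂ (fun r => g m r) f + mkDerivation ℂ (fun s => g s m) f) := by
  classical
  set S : Finset (ℤ × ℤ) := insert m ((X m * f).vars ∪ f.vars) with hS
  have hf : f.vars ⊆ S := by intro a ha; simp [hS, ha]
  have hXf : (X m * f).vars ⊆ S := by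
    intro a ha; rw [hS]; exact Finset.mem_insert_of_mem (Finset.mem_union_left _ ha)
  have hm : m ∈ S := by simp [hS]
  have hD : ∀ h : ℤ × ℤ → PP, mkDerivation ℂ h f = ∑ s ∈ S, h s * pderiv s f := fun h => by
    rw [← sum_vars_mul_pderiv]
    exact Finset.sum_subset hf fun r _ hr => by
      rw [pderiv_eq_zero_of_notMem_vars hr, mul_zero]
  have key : ∀ s r, g s r * pderiv s (pderiv r (X m * f)) =
      X m * (g s r * pderiv s (pderiv r f)) +
      ((if s = m then g m r * pderiv r f else 0) + (if r = m then g s m * pderiv s f else 0)) := by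
    intro s r
    simp only [Derivation.leibniz, pderiv_X, Pi.single_apply, smul_eq_mul, map_add]
    by_cases h1 : s = m <;> by_cases h2 : r = m <;>
      simp [h1, h2, Ne.symm] <;> ring
  rw [secondOrder_eq_of_subset g hXf, secondOrder_eq_of_subset g hf, hD, hD]
  simp only [key, Finset.sum_add_distrib, ← Finset.mul_sum, Finset.sum_ite_eq', hm, if_true]
  congr 2
  rw [Finset.sum_comm]
  simp [hm]

/-- The operators `E_{ij}(n)` as linear endomorphisms. -/
noncomputable def gen (q μ : ℂ) : Fin 2 → Fin 2 → ℤ × ℤ → Module.End ℂ PP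
  | 0, 0, n => (if n = 0 then μ • 1 else 0) -
      (mkDerivation ℂ fun s => q ^ (s.2 * n.1) • X (n + s) : Derivation ℂ PP PP).toLinearMap
  | 0, 1, n => (q ^ (-(n.1 * n.2)) * μ) • (pderiv (-n)).toLinearMap -
      { toFun := secondOrder fun s r =>
          q ^ (n.2 * r.1 + s.2 * n.1 + s.2 * r.1) • X (n + s + r)
        map_add' := secondOrder_add _
        map_smul' := secondOrder_smul _ }
  | 1, 0, n => LinearMap.mulLeft ℂ (X n)
  | 1, 1, n =>
      (mkDerivation ℂ fun s => q ^ (s.1 * n.2) • X (n + s) : Derivation ℂ PP PP).toLinearMap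

/-- The degree derivation with weight `w`. -/
noncomputable def degree (w : ℤ × ℤ → ℂ) : Module.End ℂ PP :=
  (mkDerivation ℂ fun s => w s • X s : Derivation ℂ PP PP).toLinearMap

theorem EopP_eq_gen (q μ : ℂ) (i j : Fin 2) (n : ℤ × ℤ) (f : PP) :
    EopP q μ i j n f = gen q μ i j n f := by
  fin_cases i <;> fin_cases j
  · by_cases hn : n = 0 <;>
      simp [EopP, gen, E11P, ← sum_vars_mul_pderiv, hn]
  · simp [EopP, gen, E12P, secondOrder, smul_smul]
  · simp [EopP, gen, E21P]
  · simp [EopP, gen, E22P, ← sum_vars_mul_pderiv]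

theorem D1P_eq_degree (f : PP) : D1P f = degree (fun s => (s.1 : ℂ)) f := by
  simp [D1P, degree, ← sum_vars_mul_pderiv]

theorem D2P_eq_degree (f : PP) : D2P f = degree (fun s => (s.2 : ℂ)) f := by
  simp [D2P, degree, ← sum_vars_mul_pderiv]

attribute [local instance] LieRing.ofAssociativeRing

theorem smul_bracket (c : ℂ) (Y Z : Module.End ℂ PP) : ⁅c • Y, Z⁆ = c • ⁅Y, Z⁆ := by
  simp [LieRing.of_associative_ring_bracket, smul_sub]

theorem bracket_smul (c : ℂ) (Y Z : Module.End ℂ PP) : ⁅Y, c • Z⁆ = c • ⁅Y, Z⁆ := by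
  simp [LieRing.of_associative_ring_bracket, smul_sub]

/-- An endomorphism killing `1` and commuting with multiplication by every variable vanishes. -/
theorem end_eq_zero {Z : Module.End ℂ PP} (h1 : Z 1 = 0)
    (hX : ∀ m, ⁅Z, LinearMap.mulLeft ℂ (X m : PP)⁆ = 0) : Z = 0 := by
  refine LinearMap.ext fun f => ?_
  induction f using MvPolynomial.induction_on with
  | C a =>
    rw [← mul_one (C a), ← smul_eq_C_mul, map_smul, h1, smul_zero]; rfl
  | add f g hf hg => simp_all
  | mul_X f m hf =>
    have := LinearMap.congr_fun (hX m) f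
    simp [LieRing.of_associative_ring_bracket] at this
    rw [mul_comm f, sub_eq_zero.mp this, hf]; simp

/-- Two endomorphisms agreeing at `1` and having the same brackets with multiplication by every
variable are equal. -/
theorem end_ext {Y Z : Module.End ℂ PP} (h1 : Y 1 = Z 1)
    (hX : ∀ m, ⁅Y, LinearMap.mulLeft ℂ (X m : PP)⁆ = ⁅Z, LinearMap.mulLeft ℂ (X m : PP)⁆) :
    Y = Z :=
  sub_eq_zero.mp <| end_eq_zero (by simp [h1]) fun m => by rw [sub_lie, hX, sub_self]

section relations

variable (q μ : ℂ)

theorem gen_zero_zero_one (n : ℤ × ℤ) : gen q μ 0 0 n 1 = if n = 0 then μ • 1 else 0 := by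
  by_cases hn : n = 0 <;> simp [gen, hn]

theorem gen_zero_one_one (n : ℤ × ℤ) : gen q μ 0 1 n 1 = 0 := by
  simp [gen, secondOrder]

theorem gen_one_one_one (n : ℤ × ℤ) : gen q μ 1 1 n 1 = 0 := by
  simp [gen]

theorem degree_one (w : ℤ × ℤ → ℂ) : degree w 1 = 0 := by
  simp [degree]

theorem lie_gen_zero_zero_gen_one_zero (u n : ℤ × ℤ) :
    ⁅gen q μ 0 0 u, gen q μ 1 0 n⁆ = -(q ^ (n.2 * u.1) • gen q μ 1 0 (u + n)) := by
  refine LinearMap.ext fun f => ?_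
  by_cases hu : u = 0 <;>
    simp [LieRing.of_associative_ring_bracket, gen, Derivation.leibniz, hu, mkDerivation_X,
      smul_eq_C_mul] <;> ring

theorem lie_gen_one_one_gen_one_zero (u n : ℤ × ℤ) :
    ⁅gen q μ 1 1 u, gen q μ 1 0 n⁆ = q ^ (u.2 * n.1) • gen q μ 1 0 (u + n) := by
  refine LinearMap.ext fun f => ?_
  simp [LieRing.of_associative_ring_bracket, gen, Derivation.leibniz, mkDerivation_X, mul_comm]

theorem lie_gen_zero_one_gen_one_zero {q : ℂ} (hq : q ≠ 0) (u n : ℤ × ℤ) :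
    ⁅gen q μ 0 1 u, gen q μ 1 0 n⁆ =
      q ^ (u.2 * n.1) • gen q μ 0 0 (u + n) - q ^ (n.2 * u.1) • gen q μ 1 1 (u + n) := by
  refine LinearMap.ext fun f => ?_
  have h1 : (mkDerivation ℂ fun r => q ^ (u.2 * r.1 + n.2 * u.1 + n.2 * r.1) • X (u + n + r) :
      Derivation ℂ PP PP) =
      q ^ (n.2 * u.1) • mkDerivation ℂ fun s => q ^ (s.1 * (u + n).2) • X (u + n + s) := by
    refine derivation_ext fun r => ?_
    simp only [mkDerivation_X, Derivation.smul_apply, smul_smul, ← zpow_add₀ hq, Prod.snd_add]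
    congr 2; ring
  have h2 : (mkDerivation ℂ fun s => q ^ (u.2 * n.1 + s.2 * u.1 + s.2 * n.1) • X (u + s + n) :
      Derivation ℂ PP PP) =
      q ^ (u.2 * n.1) • mkDerivation ℂ fun s => q ^ (s.2 * (u + n).1) • X (u + n + s) := by
    refine derivation_ext fun r => ?_
    simp only [mkDerivation_X, Derivation.smul_apply, smul_smul, ← zpow_add₀ hq, Prod.fst_add,
      add_right_comm u n r]
    congr 2; ring
  by_cases hu : u + n = 0
  · obtain rfl : n = -u := by rw [← sub_eq_zero, sub_neg_eq_add, add_comm, hu]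
    have h3 (c : ℂ) : (mkDerivation ℂ fun r => c • X r : Derivation ℂ PP PP) =
        c • mkDerivation ℂ fun r => X r := derivation_ext fun r => by simp [mkDerivation_X]
    simp [LieRing.of_associative_ring_bracket, gen, Derivation.leibniz, secondOrder_X_mul, h3,
      mul_comm u.2 u.1]
    simp only [smul_eq_C_mul, map_mul]
    ring
  · have hn : n ≠ -u := fun h => hu (by rw [h, add_neg_cancel])
    simp [LieRing.of_associative_ring_bracket, gen, Derivation.leibniz, secondOrder_X_mul, h1, h2,
      hu, pderiv_X, hn]
    simp only [smul_eq_C_mul]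
    ring

theorem lie_degree_gen_one_zero (w : ℤ × ℤ → ℂ) (n : ℤ × ℤ) :
    ⁅degree w, gen q μ 1 0 n⁆ = w n • gen q μ 1 0 n := by
  refine LinearMap.ext fun f => ?_
  simp [LieRing.of_associative_ring_bracket, gen, degree, Derivation.leibniz, mkDerivation_X,
    mul_comm]

/-- The commutation relation between the families `E_{ij}` and `E_{kl}`. -/
abbrev Relation (i j k l : Fin 2) : Prop :=
  ∀ u n : ℤ × ℤ, ⁅gen q μ i j u, gen q μ k l n⁆ =
    (if j = k then q ^ (u.2 * n.1) • gen q μ i l (u + n) else 0) -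
      (if i = l then q ^ (n.2 * u.1) • gen q μ k j (u + n) else 0)

variable {q μ}

theorem Relation.symm {i j k l : Fin 2} (h : Relation q μ i j k l) : Relation q μ k l i j := by
  intro u n
  rw [← lie_skew, h n u, neg_sub, add_comm u n]
  simp only [eq_comm]

theorem relation_one_one_one_one (hq : q ≠ 0) : Relation q μ 1 1 1 1 := by
  intro u n
  refine end_ext ?_ fun m => ?_
  · simp [LieRing.of_associative_ring_bracket, gen_one_one_one]
  · change ⁅_, gen q μ 1 0 m⁆ = ⁅_, gen q μ 1 0 m⁆
    rw [lie_lie]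
    simp only [if_true, Fin.isValue,
      sub_lie, smul_bracket, bracket_smul,
      lie_gen_one_one_gen_one_zero]
    simp only [Prod.fst_add, Prod.snd_add, mul_add, add_mul, zpow_add₀ hq, add_left_comm,
      add_comm]
    module

theorem relation_zero_zero_one_one (hq : q ≠ 0) : Relation q μ 0 0 1 1 := by
  intro u n
  refine end_ext ?_ fun m => ?_
  · simp [LieRing.of_associative_ring_bracket, gen_zero_zero_one, gen_one_one_one, apply_ite, map_smul]
  · change ⁅_, gen q μ 1 0 m⁆ = ⁅_, gen q μ 1 0 m⁆
    rw [lie_lie]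
    simp only [if_false, zero_ne_one, Fin.isValue,
      sub_self, lie_neg, zero_lie, bracket_smul,
      lie_gen_one_one_gen_one_zero, lie_gen_zero_zero_gen_one_zero]
    simp only [Prod.fst_add, Prod.snd_add, mul_add, add_mul, zpow_add₀ hq, add_left_comm]
    module

theorem relation_zero_zero_zero_zero (hq : q ≠ 0) : Relation q μ 0 0 0 0 := by
  intro u n
  refine end_ext ?_ fun m => ?_
  · by_cases h : u + n = 0
    · obtain rfl : n = -u := by rw [← sub_eq_zero, sub_neg_eq_add, add_comm, h]
      by_cases hu : u = 0 <;>
        simp [LieRing.of_associative_ring_bracket, gen_zero_zero_one, hu, mul_comm u.2]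
    · by_cases hu : u = 0 <;> by_cases hn : n = 0 <;>
        simp_all [LieRing.of_associative_ring_bracket, gen_zero_zero_one]
  · change ⁅_, gen q μ 1 0 m⁆ = ⁅_, gen q μ 1 0 m⁆
    rw [lie_lie]
    simp only [if_true, Fin.isValue,
      sub_lie, lie_neg, smul_bracket, bracket_smul,
      lie_gen_zero_zero_gen_one_zero]
    simp only [Prod.fst_add, Prod.snd_add, mul_add, add_mul, zpow_add₀ hq, add_left_comm,
      add_comm]
    module

theorem relation_zero_one_zero_zero (hq : q ≠ 0) : Relation q μ 0 1 0 0 := by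
  intro u n
  refine end_ext ?_ fun m => ?_
  · simp [LieRing.of_associative_ring_bracket, gen_zero_zero_one, gen_zero_one_one,
      apply_ite, map_smul]
  · change ⁅_, gen q μ 1 0 m⁆ = ⁅_, gen q μ 1 0 m⁆
    rw [lie_lie]
    simp only [if_true, if_false, zero_ne_one, one_ne_zero, zero_sub, Fin.isValue,
      sub_self, lie_sub, neg_lie, lie_neg, smul_bracket, bracket_smul,
      lie_gen_zero_zero_gen_one_zero, lie_gen_zero_one_gen_one_zero μ hq,
      relation_zero_zero_zero_zero hq _ _,
      relation_zero_zero_one_one hq _ _]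
    simp only [Prod.fst_add, Prod.snd_add, mul_add, add_mul, zpow_add₀ hq, add_left_comm,
      add_comm]
    module

theorem relation_zero_one_one_one (hq : q ≠ 0) : Relation q μ 0 1 1 1 := by
  intro u n
  refine end_ext ?_ fun m => ?_
  · simp [LieRing.of_associative_ring_bracket, gen_zero_one_one,
      gen_one_one_one]
  · change ⁅_, gen q μ 1 0 m⁆ = ⁅_, gen q μ 1 0 m⁆
    rw [lie_lie]
    simp only [if_true, if_false, zero_ne_one, one_ne_zero, sub_zero, Fin.isValue,
      sub_self, lie_sub, smul_bracket, bracket_smul,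
      lie_gen_one_one_gen_one_zero, lie_gen_zero_one_gen_one_zero μ hq,
      relation_one_one_one_one hq _ _,
      (relation_zero_zero_one_one hq).symm _ _]
    simp only [Prod.fst_add, Prod.snd_add, mul_add, add_mul, zpow_add₀ hq, add_left_comm,
      add_comm]
    module

theorem relation_zero_one_zero_one (hq : q ≠ 0) : Relation q μ 0 1 0 1 := by
  intro u n
  refine end_ext ?_ fun m => ?_
  · simp [LieRing.of_associative_ring_bracket, gen_zero_one_one]
  · change ⁅_, gen q μ 1 0 m⁆ = ⁅_, gen q μ 1 0 m⁆
    rw [lie_lie]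
    simp only [if_true, if_false, zero_ne_one, one_ne_zero, sub_zero, zero_sub, Fin.isValue,
      sub_self, lie_sub, zero_lie, bracket_smul,
      lie_gen_zero_one_gen_one_zero μ hq,
      relation_zero_one_zero_zero hq _ _,
      relation_zero_one_one_one hq _ _]
    simp only [Prod.fst_add, Prod.snd_add, mul_add, add_mul, zpow_add₀ hq, add_left_comm]
    module

theorem relation (hq : q ≠ 0) (i j k l : Fin 2) : Relation q μ i j k l := by
  have h00 : Relation q μ 0 0 1 0 := fun u n => by
    simp [lie_gen_zero_zero_gen_one_zero]
  have h11 : Relation q μ 1 1 1 0 := fun u n => by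
    simp [lie_gen_one_one_gen_one_zero]
  have h01 : Relation q μ 0 1 1 0 := fun u n => by
    simp [lie_gen_zero_one_gen_one_zero μ hq]
  have h10 : Relation q μ 1 0 1 0 := fun u n => by
    refine LinearMap.ext fun f => ?_
    simp [LieRing.of_associative_ring_bracket, gen, mul_left_comm]
  fin_cases i <;> fin_cases j <;> fin_cases k <;> fin_cases l
  · exact relation_zero_zero_zero_zero hq
  · exact (relation_zero_one_zero_zero hq).symm
  · exact h00
  · exact relation_zero_zero_one_one hq
  · exact relation_zero_one_zero_zero hq
  · exact relation_zero_one_zero_one hq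
  · exact h01
  · exact relation_zero_one_one_one hq
  · exact h00.symm
  · exact h01.symm
  · exact h10
  · exact h11.symm
  · exact (relation_zero_zero_one_one hq).symm
  · exact (relation_zero_one_one_one hq).symm
  · exact h11
  · exact relation_one_one_one_one hq

theorem lie_degree_gen (hq : q ≠ 0) (w : ℤ × ℤ →+ ℂ) (i j : Fin 2) (n : ℤ × ℤ) :
    ⁅degree w, gen q μ i j n⁆ = w n • gen q μ i j n := by
  have h00 (n) : ⁅degree w, gen q μ 0 0 n⁆ = w n • gen q μ 0 0 n := by
    refine end_ext ?_ fun m => ?_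
    · by_cases hn : n = 0 <;>
        simp [LieRing.of_associative_ring_bracket, gen_zero_zero_one, degree_one, hn]
    · change ⁅_, gen q μ 1 0 m⁆ = ⁅_, gen q μ 1 0 m⁆
      rw [lie_lie]
      simp only [smul_bracket, bracket_smul, lie_neg, lie_gen_zero_zero_gen_one_zero,
        lie_degree_gen_one_zero, map_add]
      module
  have h11 (n) : ⁅degree w, gen q μ 1 1 n⁆ = w n • gen q μ 1 1 n := by
    refine end_ext ?_ fun m => ?_
    · simp [LieRing.of_associative_ring_bracket, gen_one_one_one, degree_one]
    · change ⁅_, gen q μ 1 0 m⁆ = ⁅_, gen q μ 1 0 m⁆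
      rw [lie_lie]
      simp only [smul_bracket, bracket_smul, lie_gen_one_one_gen_one_zero,
        lie_degree_gen_one_zero, map_add]
      module
  fin_cases i <;> fin_cases j
  · exact h00 n
  · refine end_ext ?_ fun m => ?_
    · simp [LieRing.of_associative_ring_bracket, gen_zero_one_one, degree_one]
    · change ⁅_, gen q μ 1 0 m⁆ = ⁅_, gen q μ 1 0 m⁆
      rw [lie_lie]
      simp only [Fin.zero_eta, Fin.mk_one, Fin.isValue, smul_bracket, bracket_smul, lie_sub,
        lie_gen_zero_one_gen_one_zero μ hq, lie_degree_gen_one_zero, h00, h11, map_add]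
      module
  · exact lie_degree_gen_one_zero q μ w n
  · exact h11 n

theorem lie_degree_degree (w w' : ℤ × ℤ → ℂ) : ⁅degree w, degree w'⁆ = 0 := by
  refine end_ext (by simp [LieRing.of_associative_ring_bracket, degree_one]) fun m => ?_
  change ⁅_, gen 1 0 1 0 m⁆ = ⁅_, gen 1 0 1 0 m⁆
  rw [lie_lie, zero_lie]
  simp only [bracket_smul, lie_degree_gen_one_zero]
  module

end relations

end QuantumTorus

/-- the operators satisfy the defining relations of `\widehat{gl_2(ℂ_q)}`. -/
theorem stmt0 (q μ : ℂ) (hq : q ≠ 0) :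
    (∀ (i j k l : Fin 2) (u n : ℤ × ℤ) (f : PP),
      EopP q μ i j u (EopP q μ k l n f) - EopP q μ k l n (EopP q μ i j u f) =
        (if j = k then q ^ (u.2 * n.1) • EopP q μ i l (u + n) f else 0) -
        (if i = l then q ^ (n.2 * u.1) • EopP q μ k j (u + n) f else 0)) ∧
    (∀ (i j : Fin 2) (n : ℤ × ℤ) (f : PP),
      D1P (EopP q μ i j n f) - EopP q μ i j n (D1P f) = (n.1 : ℂ) • EopP q μ i j n f ∧
      D2P (EopP q μ i j n f) - EopP q μ i j n (D2P f) = (n.2 : ℂ) • EopP q μ i j n f) ∧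
    (∀ f : PP, D1P (D2P f) - D2P (D1P f) = 0) := by
  refine ⟨fun i j k l u n f => ?_, fun i j n f => ⟨?_, ?_⟩, fun f => ?_⟩
  · have h := LinearMap.congr_fun (QuantumTorus.relation (μ := μ) hq i j k l u n) f
    simp only [QuantumTorus.EopP_eq_gen]
    rw [LieRing.of_associative_ring_bracket] at h
    refine h.trans ?_
    split_ifs <;> simp
  · have h := LinearMap.congr_fun (QuantumTorus.lie_degree_gen (μ := μ) hq
      ((Int.castAddHom ℂ).comp (AddMonoidHom.fst ℤ ℤ)) i j n) f
    rw [LieRing.of_associative_ring_bracket] at h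
    simp only [QuantumTorus.EopP_eq_gen, QuantumTorus.D1P_eq_degree]
    exact h
  · have h := LinearMap.congr_fun (QuantumTorus.lie_degree_gen (μ := μ) hq
      ((Int.castAddHom ℂ).comp (AddMonoidHom.snd ℤ ℤ)) i j n) f
    rw [LieRing.of_associative_ring_bracket] at h
    simp only [QuantumTorus.EopP_eq_gen, QuantumTorus.D2P_eq_degree]
    exact h
  · have h := LinearMap.congr_fun
      (QuantumTorus.lie_degree_degree (fun s => (s.1 : ℂ)) fun s => (s.2 : ℂ)) f
    rw [LieRing.of_associative_ring_bracket] at h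
    simp only [QuantumTorus.D1P_eq_degree, QuantumTorus.D2P_eq_degree]
    exact h
end

section
/- The constant polynomial 1 ∈ P is a highest weight vector: E12(n)(1) = 0 for every n ∈ ℤ², E11(0)(1) = μ·1, E22(0)(1) = 0, D1(1) = D2(1) = 0; moreover the smallest subspace of P containing 1 and invariant under all the operators E_{ij}(n) (i,j ∈ {1,2}, n ∈ ℤ²), D1, D2 is P itself. -/
open MvPolynomial

/-- `1 ∈ P` is a highest weight vector generating `P`. -/
theorem stmt1 (q μ : ℂ) (hq : q ≠ 0) :
    (∀ n : ℤ × ℤ, E12P q μ n 1 = 0) ∧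
    E11P q μ 0 1 = μ • (1 : PP) ∧ E22P q 0 1 = 0 ∧ D1P 1 = 0 ∧ D2P 1 = 0 ∧
    (∀ W : Submodule ℂ PP, (1 : PP) ∈ W →
      (∀ (n : ℤ × ℤ) (f : PP), f ∈ W →
        E11P q μ n f ∈ W ∧ E12P q μ n f ∈ W ∧ E21P n f ∈ W ∧ E22P q n f ∈ W) →
      (∀ f ∈ W, D1P f ∈ W ∧ D2P f ∈ W) → W = ⊤) := by
  refine ⟨fun n => ?_, ?_, ?_, ?_, ?_, fun W h1 hE _ => ?_⟩
  · simp [E12P]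
  · simp [E11P]
  · simp [E22P]
  · simp [D1P]
  · simp [D2P]
  · rw [eq_top_iff]
    rintro f -
    induction f using MvPolynomial.induction_on with
    | C a =>
      rw [← mul_one (C a), ← smul_eq_C_mul]
      exact W.smul_mem a h1
    | add f g hf hg => exact W.add_mem hf hg
    | mul_X f n hf =>
      rw [mul_comm]
      exact (hE n f hf).2.2.1
end

section
/- The only subspaces of P that are invariant under all the operators E_{ij}(n) (i,j ∈ {1,2}, n ∈ ℤ²), D1, D2 are {0} and P itself if and only if μ ≠ 0. -/
open MvPolynomial

/-- A vector-valued exponential sum with nonzero bases that vanishes for all large exponents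
vanishes at exponent `0`. -/
theorem sum_eq_zero_of_forall_ge_sum_pow_smul_eq_zero {K V ι : Type*} [Field K] [AddCommGroup V]
    [Module K V] (S : Finset ι) (a : ι → K) (v : ι → V) (ha : ∀ i ∈ S, a i ≠ 0) (N : ℕ)
    (h : ∀ k, N ≤ k → ∑ i ∈ S, a i ^ k • v i = 0) : ∑ i ∈ S, v i = 0 := by
  have hcop : IsCoprime ((Polynomial.X : Polynomial K) ^ N)
      (∏ i ∈ S, (Polynomial.X - Polynomial.C (a i))) := by
    refine IsCoprime.pow_left (IsCoprime.prod_right fun i hi => ?_)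
    simpa using Polynomial.isCoprime_X_sub_C_of_isUnit_sub (R := K) (a := 0) (b := a i)
      (by simpa using ha i hi)
  obtain ⟨u, w, huw⟩ := hcop
  have heval : ∀ i ∈ S, (u * Polynomial.X ^ N).eval (a i) = 1 := by
    intro i hi
    have := congrArg (Polynomial.eval (a i)) huw
    rwa [Polynomial.eval_add, Polynomial.eval_mul (p := w), Polynomial.eval_prod,
      Finset.prod_eq_zero hi (by simp), mul_zero, add_zero, Polynomial.eval_one] at this
  calc ∑ i ∈ S, v i = ∑ i ∈ S, (u * Polynomial.X ^ N).eval (a i) • v i :=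
        Finset.sum_congr rfl fun i hi => by rw [heval i hi, one_smul]
    _ = ∑ i ∈ S, ∑ j ∈ u.support, u.coeff j • a i ^ (j + N) • v i := by
        refine Finset.sum_congr rfl fun i _ => ?_
        rw [Polynomial.eval_mul, Polynomial.eval_pow, Polynomial.eval_X,
          Polynomial.eval_eq_sum, Polynomial.sum, Finset.sum_mul, Finset.sum_smul]
        exact Finset.sum_congr rfl fun j _ => by rw [smul_smul, pow_add, mul_assoc]
    _ = ∑ j ∈ u.support, u.coeff j • ∑ i ∈ S, a i ^ (j + N) • v i := by
        rw [Finset.sum_comm]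
        simp only [Finset.smul_sum]
    _ = 0 := Finset.sum_eq_zero fun j _ => by rw [h _ (Nat.le_add_left _ _), smul_zero]

namespace MvPolynomial

theorem vars_pderiv_subset {σ R : Type*} [CommSemiring R] (i : σ) (f : MvPolynomial σ R) :
    (pderiv i f).vars ⊆ f.vars := by
  intro j hj
  obtain ⟨d, hd, hjd⟩ := (mem_vars_iff_mem_support _).mp hj
  rw [mem_support_iff, coeff_pderiv] at hd
  refine (mem_vars_iff_mem_support _).mpr
    ⟨d + Finsupp.single i 1, mem_support_iff.mpr (left_ne_zero_of_mul hd), ?_⟩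
  simp only [Finsupp.mem_support_iff, Finsupp.add_apply] at hjd ⊢
  omega

theorem totalDegree_pderiv_le {σ R : Type*} [CommSemiring R] (i : σ) (f : MvPolynomial σ R) :
    (pderiv i f).totalDegree ≤ f.totalDegree - 1 := by
  refine Finset.sup_le fun d hd => ?_
  rw [mem_support_iff, coeff_pderiv] at hd
  have := le_totalDegree (mem_support_iff.mpr (left_ne_zero_of_mul hd))
  rw [Finsupp.sum_add_index' (fun _ => rfl) (fun _ _ _ => rfl),
    Finsupp.sum_single_index rfl] at this
  omega

theorem vars_eq_empty_of_forall_pderiv_eq_zero {σ R : Type*} [CommSemiring R] [NoZeroDivisors R]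
    [CharZero R] {f : MvPolynomial σ R} (h : ∀ i, pderiv i f = 0) : f.vars = ∅ := by
  refine Finset.eq_empty_of_forall_notMem fun i hi => ?_
  obtain ⟨d, hd, hid⟩ := (mem_vars_iff_mem_support _).mp hi
  have hle : Finsupp.single i 1 ≤ d :=
    Finsupp.single_le_iff.mpr (Nat.one_le_iff_ne_zero.mpr (Finsupp.mem_support_iff.mp hid))
  have := congrArg (coeff (d - Finsupp.single i 1)) (h i)
  rw [coeff_pderiv, tsub_add_cancel_of_le hle, coeff_zero] at this
  rcases mul_eq_zero.mp this with h0 | h0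
  · exact mem_support_iff.mp hd h0
  · exact Nat.cast_add_one_ne_zero _ h0

theorem rename_eq_self_of_forall_mem_vars {σ R : Type*} [CommSemiring R] {g : σ → σ}
    {f : MvPolynomial σ R} (h : ∀ i ∈ f.vars, g i = i) : rename g f = f := by
  have : (rename g : MvPolynomial σ R →ₐ[R] MvPolynomial σ R).toRingHom f = RingHom.id _ f :=
    hom_congr_vars (by ext; simp) (fun i hi _ => by simp [h i hi]) rfl
  simpa using this

end MvPolynomial

theorem totalDegree_E12P_le (q μ : ℂ) (n : ℤ × ℤ) (f : PP) :
    (E12P q μ n f).totalDegree ≤ f.totalDegree - 1 := by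
  refine (totalDegree_sub _ _).trans (max_le ?_ ?_)
  · exact (totalDegree_smul_le _ _).trans <|
      (totalDegree_smul_le _ _).trans (totalDegree_pderiv_le _ f)
  · refine totalDegree_finsetSum_le fun s _ => totalDegree_finsetSum_le fun r _ => ?_
    refine (totalDegree_smul_le _ _).trans ?_
    by_cases h0 : pderiv s (pderiv r f) = 0
    · simp [h0]
    have h1 := totalDegree_pderiv_le r f
    have h2 := totalDegree_pderiv_le s (pderiv r f)
    have h3 : (pderiv r f).totalDegree ≠ 0 := by
      intro h
      rw [totalDegree_eq_zero_iff_eq_C] at h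
      rw [h, pderiv_C] at h0
      exact h0 rfl
    have h4 := totalDegree_mul (X (n + s + r)) (pderiv s (pderiv r f))
    rw [totalDegree_X] at h4
    omega

theorem exists_forall_ge_shift_notMem (S : Finset (ℤ × ℤ)) (n : ℤ × ℤ) :
    ∃ N : ℕ, ∀ k : ℕ, N ≤ k → -(n + ((k : ℤ), 0)) ∉ S ∧
      ∀ s ∈ S, ∀ r ∈ S, n + ((k : ℤ), 0) + s + r ∉ S := by
  obtain ⟨M, hM⟩ : ∃ M : ℤ, ∀ s ∈ S, |s.1| ≤ M :=
    ⟨∑ s ∈ S, |s.1|, fun s hs =>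
      Finset.single_le_sum (f := fun s : ℤ × ℤ => |s.1|) (fun _ _ => abs_nonneg _) hs⟩
  refine ⟨(|n.1| + 3 * |M| + 1).toNat, fun k hk => ⟨fun h => ?_, fun s hs r hr h => ?_⟩⟩
  · have := hM _ h
    simp only [Prod.fst_neg, Prod.fst_add] at this
    grind
  · have h1 := hM _ h
    have h2 := hM _ hs
    have h3 := hM _ hr
    simp only [Prod.fst_add] at h1
    grind

/-- If all `E12(n)` annihilate `f`, then their second-order parts annihilate `f` as well. -/
theorem second_order_part_eq_zero {q μ : ℂ} (hq : q ≠ 0) {f : PP}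
    (h : ∀ n, E12P q μ n f = 0) (n : ℤ × ℤ) :
    ∑ s ∈ f.vars, ∑ r ∈ f.vars,
      q ^ (n.2 * r.1 + s.2 * n.1 + s.2 * r.1) • (X (n + s + r) * pderiv s (pderiv r f)) = 0 := by
  obtain ⟨N, hN⟩ := exists_forall_ge_shift_notMem f.vars n
  rw [← Finset.sum_product']
  refine sum_eq_zero_of_forall_ge_sum_pow_smul_eq_zero (f.vars ×ˢ f.vars)
    (fun p => q ^ p.1.2) _ (fun p _ => zpow_ne_zero _ hq) N fun k hk => ?_
  obtain ⟨hk1, hk2⟩ := hN k hk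
  have hE := h (n + ((k : ℤ), 0))
  rw [E12P, pderiv_eq_zero_of_notMem_vars hk1, smul_zero, smul_zero, zero_sub, neg_eq_zero,
    ← Finset.sum_product'] at hE
  let g : ℤ × ℤ → ℤ × ℤ := fun j => if j ∈ f.vars then j else j - ((k : ℤ), 0)
  have hg := congrArg (rename g) hE
  rw [map_zero, map_sum] at hg
  refine Eq.trans (Finset.sum_congr rfl fun p hp => ?_) hg
  obtain ⟨hs, hr⟩ := Finset.mem_product.mp hp
  have hgX : g (n + ((k : ℤ), 0) + p.1 + p.2) = n + p.1 + p.2 := by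
    simp only [g, if_neg (hk2 _ hs _ hr)]
    abel
  have hgf : rename g (pderiv p.1 (pderiv p.2 f)) = pderiv p.1 (pderiv p.2 f) :=
    rename_eq_self_of_forall_mem_vars fun i hi =>
      if_pos (vars_pderiv_subset _ _ (vars_pderiv_subset _ _ hi))
  rw [map_smul, map_mul, rename_X, hgX, hgf, smul_smul, ← zpow_natCast, ← zpow_mul,
    ← zpow_add₀ hq]
  congr 2
  simp only [Prod.fst_add, Prod.snd_add]
  ring

theorem vars_eq_empty_of_forall_E12P_eq_zero {q μ : ℂ} (hq : q ≠ 0) (hμ : μ ≠ 0) {f : PP}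
    (h : ∀ n, E12P q μ n f = 0) : f.vars = ∅ := by
  refine vars_eq_empty_of_forall_pderiv_eq_zero fun i => ?_
  have hE := h (-i)
  rw [E12P, second_order_part_eq_zero hq h, sub_zero, neg_neg] at hE
  exact (smul_eq_zero_iff_right hμ).mp
    ((smul_eq_zero_iff_right (zpow_ne_zero _ hq)).mp hE)

theorem one_mem_of_E12P_invariant {q μ : ℂ} (hq : q ≠ 0) (hμ : μ ≠ 0) {W : Submodule ℂ PP}
    (hW : ∀ n, ∀ f ∈ W, E12P q μ n f ∈ W) {f : PP} (hf : f ∈ W) (hf0 : f ≠ 0) : 1 ∈ W := by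
  induction hd : f.totalDegree using Nat.strong_induction_on generalizing f with
  | _ d ih =>
  by_cases h : ∀ n, E12P q μ n f = 0
  · have hC := vars_eq_empty_iff_eq_C.mp (vars_eq_empty_of_forall_E12P_eq_zero hq hμ h)
    have hc : f.coeff 0 ≠ 0 := fun hc => hf0 (by rw [hC, hc, C_0])
    rw [hC] at hf
    have := W.smul_mem (f.coeff 0)⁻¹ hf
    rwa [smul_eq_C_mul, ← C_mul, inv_mul_cancel₀ hc, C_1] at this
  · push Not at h
    obtain ⟨n, hn⟩ := h
    refine ih _ ?_ (hW n f hf) hn rfl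
    have hle := totalDegree_E12P_le q μ n f
    rcases Nat.eq_zero_or_pos f.totalDegree with h0 | h0
    · refine absurd ?_ hn
      rw [totalDegree_eq_zero_iff_eq_C] at h0
      have hv : f.vars = ∅ := vars_eq_empty_iff_eq_C.mpr h0
      rw [E12P, hv, pderiv_eq_zero_of_notMem_vars (by simp [hv])]
      simp
    · omega

theorem eq_top_of_one_mem_of_X_mul_mem {σ R : Type*} [CommSemiring R]
    {W : Submodule R (MvPolynomial σ R)} (h1 : 1 ∈ W) (hX : ∀ i, ∀ f ∈ W, X i * f ∈ W) :
    W = ⊤ := by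
  refine Submodule.eq_top_iff'.mpr fun f => ?_
  induction f using MvPolynomial.induction_on with
  | C a => simpa [smul_eq_C_mul] using W.smul_mem a h1
  | add p r hp hr => exact W.add_mem hp hr
  | mul_X p i hp => rw [mul_comm]; exact hX i p hp

/-- the module `ℂ[x]` is irreducible iff `μ ≠ 0`. -/
theorem stmt2 (q μ : ℂ) (hq : q ≠ 0) :
    (∀ W : Submodule ℂ PP,
      (∀ (n : ℤ × ℤ) (f : PP), f ∈ W →
        E11P q μ n f ∈ W ∧ E12P q μ n f ∈ W ∧ E21P n f ∈ W ∧ E22P q n f ∈ W) →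
      (∀ f ∈ W, D1P f ∈ W ∧ D2P f ∈ W) → W = ⊥ ∨ W = ⊤) ↔ μ ≠ 0 := by
  constructor
  · rintro h rfl
    let W : Submodule ℂ PP := LinearMap.ker (aeval (R := ℂ) (fun _ : ℤ × ℤ => (0 : ℂ))).toLinearMap
    have hmem : ∀ f : PP, f ∈ W ↔ aeval (fun _ => (0 : ℂ)) f = 0 := fun f => Iff.rfl
    rcases h W (fun n f _ => by simp [hmem, E11P, E12P, E21P, E22P])
      (fun f _ => by simp [hmem, D1P, D2P]) with hW | hW
    · have hX : (X 0 : PP) ∈ W := by simp [hmem]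
      rw [hW, Submodule.mem_bot] at hX
      exact X_ne_zero _ hX
    · have h1 : (1 : PP) ∈ W := hW ▸ Submodule.mem_top
      simp [hmem] at h1
  · intro hμ W hW _
    refine or_iff_not_imp_left.mpr fun hbot => ?_
    obtain ⟨f, hf, hf0⟩ := W.ne_bot_iff.mp hbot
    exact eq_top_of_one_mem_of_X_mul_mem
      (one_mem_of_E12P_invariant hq hμ (fun n f hf => (hW n f hf).2.1) hf hf0)
      fun i f hf => (hW i f hf).2.2.1
end

section
/- As operators on N, ad(X_m) = [X_m, −] is nilpotent on each generator: [X_m, E21(n)] = 0, (ad X_m)²(E11(n)) = 0, (ad X_m)²(E22(n)) = 0, (ad X_m)³(E12(n)) = 0, and (ad X_m)²(D1) = (ad X_m)²(D2) = 0, for every n ∈ ℤ². -/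
open MvPolynomial Finsupp

/-- The index set of the variables other than `x_m`. -/
abbrev NVar (m : ℤ × ℤ) := {p : ℤ × ℤ // p ≠ m}

/-- `N = ℂ[x_m, x_m^{−1}][x_n : n ≠ m]`, realized as finitely supported families,
indexed by the exponent of `x_m` (an arbitrary integer), of polynomials in the
variables `x_n`, `n ≠ m`. -/
abbrev NN (m : ℤ × ℤ) := ℤ →₀ MvPolynomial (NVar m) ℂ

/-- Multiplication by `x_m^j` on `N` (for `j = -1` this is `X_m^{−1}`). -/
noncomputable def XmZ (m : ℤ × ℤ) (j : ℤ) (g : NN m) : NN m :=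
  Finsupp.mapDomain (· + j) g

/-- Multiplication by `x_k` on `N` (the operator `X_k`). -/
noncomputable def Xop (m : ℤ × ℤ) (k : ℤ × ℤ) (g : NN m) : NN m :=
  if h : k = m then XmZ m 1 g
  else Finsupp.mapRange (fun a => X (⟨k, h⟩ : NVar m) * a) (by simp) g

/-- The partial derivative `∂_s` on `N` (with `∂_m x_m^k = k x_m^{k−1}`, `k ∈ ℤ`). -/
noncomputable def Dop (m : ℤ × ℤ) (s : ℤ × ℤ) (g : NN m) : NN m :=
  if h : s = m then g.sum (fun k a => Finsupp.single (k - 1) (k • a))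
  else Finsupp.mapRange (fun a => pderiv (⟨s, h⟩ : NVar m) a) (by simp) g

/-- A finite set of indices containing every `s` for which `∂_s` acts nonzero on `g`
(together with `m`); sums over all `s ∈ ℤ²` in the defining formulas reduce to sums
over this finite set. -/
noncomputable def nvars (m : ℤ × ℤ) (g : NN m) : Finset (ℤ × ℤ) :=
  insert m (g.support.biUnion fun k => (g k).vars.image Subtype.val)

/-- `E21(n)` on `N`: multiplication by `x_n`. -/
noncomputable def E21N (m n : ℤ × ℤ) (g : NN m) : NN m := Xop m n g

/-- `E22(n) = Σ_s q^{s₁n₂} x_{n+s} ∂_s` on `N`. -/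
noncomputable def E22N (q : ℂ) (m n : ℤ × ℤ) (g : NN m) : NN m :=
  ∑ s ∈ nvars m g, q ^ (s.1 * n.2) • Xop m (n + s) (Dop m s g)

/-- `E11(n) = δ_{n,0} μ id − Σ_s q^{s₂n₁} x_{n+s} ∂_s` on `N`. -/
noncomputable def E11N (q μ : ℂ) (m n : ℤ × ℤ) (g : NN m) : NN m :=
  (if n = 0 then μ • g else 0) - ∑ s ∈ nvars m g, q ^ (s.2 * n.1) • Xop m (n + s) (Dop m s g)

/-- `E12(n) = q^{−n₁n₂} μ ∂_{−n} − Σ_{s,r} q^{n₂r₁+s₂n₁+s₂r₁} x_{n+s+r} ∂_s ∂_r` on `N`. -/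
noncomputable def E12N (q μ : ℂ) (m n : ℤ × ℤ) (g : NN m) : NN m :=
  q ^ (-(n.1 * n.2)) • μ • Dop m (-n) g -
    ∑ s ∈ nvars m g, ∑ r ∈ nvars m g,
      q ^ (n.2 * r.1 + s.2 * n.1 + s.2 * r.1) • Xop m (n + s + r) (Dop m s (Dop m r g))

/-- `𝓔_m = Σ_{s,r} q^{−m₂r₁−s₂m₁+s₂r₁} x_{−m+s+r} ∂_s ∂_r` on `N`. -/
noncomputable def EmN (q : ℂ) (m : ℤ × ℤ) (g : NN m) : NN m :=
  ∑ s ∈ nvars m g, ∑ r ∈ nvars m g,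
    q ^ (-(m.2 * r.1) - s.2 * m.1 + s.2 * r.1) • Xop m (-m + s + r) (Dop m s (Dop m r g))

/-- `D1 = Σ_s s₁ x_s ∂_s` on `N`. -/
noncomputable def D1N (m : ℤ × ℤ) (g : NN m) : NN m :=
  ∑ s ∈ nvars m g, (s.1 : ℂ) • Xop m s (Dop m s g)

/-- `D2 = Σ_s s₂ x_s ∂_s` on `N`. -/
noncomputable def D2N (m : ℤ × ℤ) (g : NN m) : NN m :=
  ∑ s ∈ nvars m g, (s.2 : ℂ) • Xop m s (Dop m s g)

/-- `ad(X_m) = [X_m, −]` acting on operators on `N` (here `X_m = ` multiplication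
by `x_m`, i.e. `XmZ m 1`). -/
noncomputable def adXm (m : ℤ × ℤ) (A : NN m → NN m) : NN m → NN m :=
  fun g => XmZ m 1 (A g) - A (XmZ m 1 g)

theorem XmZ_apply (m : ℤ × ℤ) (j : ℤ) (g : NN m) (k : ℤ) : XmZ m j g k = g (k - j) :=
  Finsupp.mapDomain_equiv_apply (f := Equiv.addRight j) g k

theorem XmZ_add (m : ℤ × ℤ) (j : ℤ) (g h : NN m) : XmZ m j (g + h) = XmZ m j g + XmZ m j h :=
  Finsupp.mapDomain_add

theorem XmZ_smul (m : ℤ × ℤ) (j : ℤ) (c : ℂ) (g : NN m) : XmZ m j (c • g) = c • XmZ m j g :=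
  Finsupp.mapDomain_smul c g

theorem XmZ_zero (m : ℤ × ℤ) (j : ℤ) : XmZ m j 0 = 0 := Finsupp.mapDomain_zero

theorem XmZ_sub (m : ℤ × ℤ) (j : ℤ) (g h : NN m) : XmZ m j (g - h) = XmZ m j g - XmZ m j h := by
  ext1 k
  simp [XmZ_apply]

theorem XmZ_sum (m : ℤ × ℤ) (j : ℤ) {ι : Type*} (s : Finset ι) (f : ι → NN m) :
    XmZ m j (∑ i ∈ s, f i) = ∑ i ∈ s, XmZ m j (f i) :=
  Finsupp.mapDomain_finsetSum

theorem Xop_add (m k : ℤ × ℤ) (g h : NN m) : Xop m k (g + h) = Xop m k g + Xop m k h := by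
  unfold Xop
  split_ifs
  · exact XmZ_add ..
  · ext1 i
    simp [mul_add]

theorem Xop_zero (m k : ℤ × ℤ) : Xop m k 0 = 0 := by
  unfold Xop
  split_ifs
  · exact XmZ_zero ..
  · simp

theorem Xop_XmZ (m k : ℤ × ℤ) (j : ℤ) (g : NN m) :
    Xop m k (XmZ m j g) = XmZ m j (Xop m k g) := by
  unfold Xop
  split_ifs
  · ext1 i
    simp only [XmZ_apply]
    congr 1
    ring
  · ext1 i
    simp [XmZ_apply]

theorem Dop_self_apply (m : ℤ × ℤ) (g : NN m) (k : ℤ) : Dop m m g k = (k + 1) • g (k + 1) := by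
  unfold Dop
  rw [dif_pos rfl, Finsupp.sum_apply, Finsupp.sum_eq_single (k + 1)]
  · simp
  · intro b _ hb
    rw [Finsupp.single_apply, if_neg (by omega)]
  · simp

theorem Dop_add (m s : ℤ × ℤ) (g h : NN m) : Dop m s (g + h) = Dop m s g + Dop m s h := by
  by_cases hs : s = m
  · subst hs
    ext1 k
    simp only [Dop_self_apply, Finsupp.add_apply, smul_add]
  · unfold Dop
    simp only [dif_neg hs]
    ext1 k
    simp

theorem Dop_zero (m s : ℤ × ℤ) : Dop m s 0 = 0 := by
  simpa using Dop_add m s 0 0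

/-- The canonical commutation relation `∂_s x_m = x_m ∂_s + δ_{s,m}`. -/
theorem Dop_XmZ (m s : ℤ × ℤ) (g : NN m) :
    Dop m s (XmZ m 1 g) = XmZ m 1 (Dop m s g) + if s = m then g else 0 := by
  split_ifs with hs
  · subst hs
    ext1 k
    simp only [Dop_self_apply, XmZ_apply, Finsupp.add_apply, add_sub_cancel_right, sub_add_cancel,
      add_smul, one_smul]
  · unfold Dop
    simp only [dif_neg hs]
    ext1 k
    simp [XmZ_apply]

theorem mem_nvars (m : ℤ × ℤ) (g : NN m) (s : ℤ × ℤ) :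
    s ∈ nvars m g ↔ s = m ∨ ∃ k, s ∈ (g k).vars.image Subtype.val := by
  unfold nvars
  rw [Finset.mem_insert, Finset.mem_biUnion]
  refine or_congr_right (exists_congr fun k => and_iff_right_of_imp fun h => ?_)
  rw [Finsupp.mem_support_iff]
  intro h0
  simp [h0] at h

theorem self_mem_nvars (m : ℤ × ℤ) (g : NN m) : m ∈ nvars m g :=
  Finset.mem_insert_self _ _

theorem nvars_XmZ (m : ℤ × ℤ) (j : ℤ) (g : NN m) : nvars m (XmZ m j g) = nvars m g := by
  ext s
  simp only [mem_nvars, XmZ_apply]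
  refine or_congr_right ⟨fun ⟨k, hk⟩ => ⟨k - j, hk⟩, fun ⟨k, hk⟩ => ⟨k + j, ?_⟩⟩
  rwa [add_sub_cancel_right]

theorem adXm_add (m : ℤ × ℤ) (A B : NN m → NN m) : adXm m (A + B) = adXm m A + adXm m B := by
  funext g
  simp only [adXm, Pi.add_apply, XmZ_add]
  abel

theorem adXm_sub (m : ℤ × ℤ) (A B : NN m → NN m) : adXm m (A - B) = adXm m A - adXm m B := by
  funext g
  simp only [adXm, Pi.sub_apply, XmZ_sub]
  abel

theorem adXm_smul (m : ℤ × ℤ) (c : ℂ) (A : NN m → NN m) : adXm m (c • A) = c • adXm m A := by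
  funext g
  simp only [adXm, Pi.smul_apply, XmZ_smul, smul_sub]

theorem adXm_zero (m : ℤ × ℤ) : adXm m 0 = 0 := by
  simpa using adXm_sub m 0 0

theorem adXm_id (m : ℤ × ℤ) : adXm m id = 0 := by
  funext g
  simp [adXm]

theorem adXm_Xop (m k : ℤ × ℤ) : adXm m (Xop m k) = 0 := by
  funext g
  simp [adXm, Xop_XmZ]

theorem adXm_Dop (m s : ℤ × ℤ) : adXm m (Dop m s) = (if s = m then -1 else 0 : ℂ) • id := by
  funext g
  rw [adXm, Dop_XmZ]
  split_ifs <;> simp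

/-- The first-order operator `Σ_s c(s) x_{k+s} ∂_s` on `N`. -/
noncomputable def firstOrderOp (m : ℤ × ℤ) (c : ℤ × ℤ → ℂ) (k : ℤ × ℤ) (g : NN m) : NN m :=
  ∑ s ∈ nvars m g, c s • Xop m (k + s) (Dop m s g)

/-- The second-order operator `Σ_{s,r} c(s,r) x_{k+s+r} ∂_s ∂_r` on `N`. -/
noncomputable def secondOrderOp (m : ℤ × ℤ) (c : ℤ × ℤ → ℤ × ℤ → ℂ) (k : ℤ × ℤ) (g : NN m) :
    NN m :=
  ∑ s ∈ nvars m g, ∑ r ∈ nvars m g, c s r • Xop m (k + s + r) (Dop m s (Dop m r g))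

theorem adXm_firstOrderOp (m : ℤ × ℤ) (c : ℤ × ℤ → ℂ) (k : ℤ × ℤ) :
    adXm m (firstOrderOp m c k) = (-c m) • Xop m (k + m) := by
  funext g
  have h (s : ℤ × ℤ) : c s • Xop m (k + s) (if s = m then g else 0) =
      if s = m then c m • Xop m (k + m) g else 0 := by
    split_ifs with hs
    · rw [hs]
    · rw [Xop_zero, smul_zero]
  simp only [adXm, firstOrderOp, nvars_XmZ, Dop_XmZ, Xop_add, Xop_XmZ, smul_add,
    Finset.sum_add_distrib, XmZ_sum, XmZ_smul, h, Finset.sum_ite_eq', self_mem_nvars, if_true,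
    Pi.smul_apply, neg_smul]
  abel

theorem adXm_sq_firstOrderOp (m : ℤ × ℤ) (c : ℤ × ℤ → ℂ) (k : ℤ × ℤ) :
    adXm m (adXm m (firstOrderOp m c k)) = 0 := by
  rw [adXm_firstOrderOp, adXm_smul, adXm_Xop, smul_zero]

theorem adXm_secondOrderOp (m : ℤ × ℤ) (c : ℤ × ℤ → ℤ × ℤ → ℂ) (k : ℤ × ℤ) :
    adXm m (secondOrderOp m c k) =
      (-1 : ℂ) • (firstOrderOp m (c m) (k + m) + firstOrderOp m (fun s => c s m) (k + m)) := by
  funext g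
  have h₁ (s r : ℤ × ℤ) : c s r • Xop m (k + s + r) (if s = m then Dop m r g else 0) =
      if s = m then c m r • Xop m (k + m + r) (Dop m r g) else 0 := by
    split_ifs with hs
    · rw [hs]
    · rw [Xop_zero, smul_zero]
  have h₂ (s r : ℤ × ℤ) : c s r • Xop m (k + s + r) (Dop m s (if r = m then g else 0)) =
      if r = m then c s m • Xop m (k + m + s) (Dop m s g) else 0 := by
    split_ifs with hr
    · rw [hr, add_right_comm]
    · rw [Dop_zero, Xop_zero, smul_zero]
  have h₃ : (∑ s ∈ nvars m g, ∑ r ∈ nvars m g,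
      if s = m then c m r • Xop m (k + m + r) (Dop m r g) else 0) =
      ∑ r ∈ nvars m g, c m r • Xop m (k + m + r) (Dop m r g) := by
    rw [Finset.sum_comm]
    simp only [Finset.sum_ite_eq', self_mem_nvars, if_true]
  simp only [adXm, secondOrderOp, firstOrderOp, nvars_XmZ, Dop_XmZ, Dop_add, Xop_add, Xop_XmZ,
    smul_add, Finset.sum_add_distrib, XmZ_sum, XmZ_smul, h₁, h₂, h₃, Finset.sum_ite_eq',
    self_mem_nvars, if_true, Pi.smul_apply, Pi.add_apply, neg_smul, one_smul]
  abel

theorem adXm_cube_secondOrderOp (m : ℤ × ℤ) (c : ℤ × ℤ → ℤ × ℤ → ℂ) (k : ℤ × ℤ) :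
    adXm m (adXm m (adXm m (secondOrderOp m c k))) = 0 := by
  simp only [adXm_secondOrderOp, adXm_smul, adXm_add, adXm_sq_firstOrderOp, add_zero, smul_zero]

theorem E22N_eq (q : ℂ) (m n : ℤ × ℤ) :
    E22N q m n = firstOrderOp m (fun s => q ^ (s.1 * n.2)) n := rfl

theorem E11N_eq (q μ : ℂ) (m n : ℤ × ℤ) :
    E11N q μ m n =
      (if n = 0 then μ else 0) • id - firstOrderOp m (fun s => q ^ (s.2 * n.1)) n := by
  funext g
  by_cases hn : n = 0 <;> simp [E11N, firstOrderOp, hn]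

theorem E12N_eq (q μ : ℂ) (m n : ℤ × ℤ) :
    E12N q μ m n = q ^ (-(n.1 * n.2)) • μ • Dop m (-n) -
      secondOrderOp m (fun s r => q ^ (n.2 * r.1 + s.2 * n.1 + s.2 * r.1)) n := rfl

theorem D1N_eq (m : ℤ × ℤ) : D1N m = firstOrderOp m (fun s => (s.1 : ℂ)) 0 := by
  funext g
  simp [D1N, firstOrderOp]

theorem D2N_eq (m : ℤ × ℤ) : D2N m = firstOrderOp m (fun s => (s.2 : ℂ)) 0 := by
  funext g
  simp [D2N, firstOrderOp]

/-- `ad(X_m)` is nilpotent on each generator. -/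
theorem stmt3 (q μ : ℂ) (hq : q ≠ 0) (m : ℤ × ℤ) (n : ℤ × ℤ) :
    adXm m (E21N m n) = 0 ∧
    (adXm m)^[2] (E11N q μ m n) = 0 ∧
    (adXm m)^[2] (E22N q m n) = 0 ∧
    (adXm m)^[3] (E12N q μ m n) = 0 ∧
    (adXm m)^[2] (D1N m) = 0 ∧
    (adXm m)^[2] (D2N m) = 0 := by
  simp only [Function.iterate_succ, Function.iterate_zero, Function.comp_apply, id]
  refine ⟨adXm_Xop m n, ?_, ?_, ?_, ?_, ?_⟩
  · simp only [E11N_eq, adXm_sub, adXm_smul, adXm_id, adXm_zero, adXm_sq_firstOrderOp, smul_zero,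
      sub_zero]
  · rw [E22N_eq, adXm_sq_firstOrderOp]
  · simp only [E12N_eq, adXm_sub, adXm_smul, adXm_Dop, adXm_id, adXm_zero,
      adXm_cube_secondOrderOp, smul_zero, sub_zero]
  · rw [D1N_eq, adXm_sq_firstOrderOp]
  · rw [D2N_eq, adXm_sq_firstOrderOp]
end

section
/- Let L be a Lie algebra over ℂ, let x ∈ L be such that ad(x) is locally nilpotent on L, and let M be a simple (irreducible) L-module. Then the action of x on M is either locally nilpotent (for every v ∈ M there exists k ∈ ℕ with x^k · v = 0) or torsion free (for every nonzero v ∈ M and every k ∈ ℕ, x^k · v ≠ 0). -/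
namespace LieModule

variable {R L M : Type*} [CommRing R] [LieRing L] [LieAlgebra R L]
  [AddCommGroup M] [Module R M] [LieRingModule L M] [LieModule R L M]

lemma mem_maxGenEigenspace_toEnd_zero_iff_iterate (x : L) (m : M) :
    m ∈ (toEnd R L M x).maxGenEigenspace 0 ↔ ∃ k : ℕ, (fun w : M => ⁅x, w⁆)^[k] m = 0 := by
  simp only [Module.End.mem_maxGenEigenspace, zero_smul, sub_zero, Module.End.pow_apply]
  rfl

variable (R M) in
/-- The vectors killed by some power of `x`, as a Lie submodule, when `ad x` is locally
nilpotent. -/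
def locallyNilpotentPart (x : L) (hx : (toEnd R L L x).maxGenEigenspace 0 = ⊤) :
    LieSubmodule R L M where
  __ := (toEnd R L M x).maxGenEigenspace 0
  lie_mem {y m} hm := by
    have h := lie_mem_maxGenEigenspace_toEnd (χ₁ := 0) (y := y) (by simp [hx]) hm
    rwa [zero_add] at h

lemma mem_locallyNilpotentPart {x : L} (hx : (toEnd R L L x).maxGenEigenspace 0 = ⊤) {m : M} :
    m ∈ locallyNilpotentPart R M x hx ↔ ∃ k : ℕ, (fun w : M => ⁅x, w⁆)^[k] m = 0 :=
  mem_maxGenEigenspace_toEnd_zero_iff_iterate x m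

end LieModule

/-- if `ad(x)` is locally nilpotent on a Lie algebra `L` over `ℂ` and `M`
is a simple `L`-module, then the action of `x` on `M` is either locally nilpotent or
torsion free. -/
theorem stmt6 (L : Type*) [LieRing L] [LieAlgebra ℂ L]
    (M : Type*) [AddCommGroup M] [Module ℂ M] [LieRingModule L M] [LieModule ℂ L M]
    (x : L)
    (hx : ∀ y : L, ∃ k : ℕ, (fun z : L => ⁅x, z⁆)^[k] y = 0)
    (hsimple : ∀ W : LieSubmodule ℂ L M, W = ⊥ ∨ W = ⊤) :
    (∀ v : M, ∃ k : ℕ, (fun w : M => ⁅x, w⁆)^[k] v = 0) ∨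
    (∀ v : M, v ≠ 0 → ∀ k : ℕ, (fun w : M => ⁅x, w⁆)^[k] v ≠ 0) := by
  have had : (LieModule.toEnd ℂ L L x).maxGenEigenspace 0 = ⊤ :=
    Submodule.eq_top_iff'.mpr fun y =>
      (LieModule.mem_maxGenEigenspace_toEnd_zero_iff_iterate x y).mpr (hx y)
  rcases hsimple (LieModule.locallyNilpotentPart ℂ M x had) with h | h
  · right
    intro v hv k hk
    have hmem := (LieModule.mem_locallyNilpotentPart had).mpr ⟨k, hk⟩
    rw [h, LieSubmodule.mem_bot] at hmem
    exact hv hmem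
  · left
    intro v
    rw [← LieModule.mem_locallyNilpotentPart had, h]
    exact LieSubmodule.mem_top v
end

section
/- For every i ∈ ℕ, in N: E12(−m)^i(x_m^{−1}) = (−1)^i q^{−i m₁m₂} i! (μ+2)(μ+3)⋯(μ+1+i) x_m^{−1−i}. -/
open MvPolynomial Finsupp

theorem nvars_single_C (m : ℤ × ℤ) (k : ℤ) (c : ℂ) :
    nvars m (single k (C c)) = {m} := by
  ext p
  simp only [nvars, Finset.mem_insert, Finset.mem_biUnion, Finset.mem_image,
    Finset.mem_singleton, or_iff_left_iff_imp]
  rintro ⟨j, -, v, hv, -⟩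
  rw [single_apply] at hv
  split_ifs at hv <;> simp at hv

theorem Dop_self_single_C (m : ℤ × ℤ) (k : ℤ) (c : ℂ) :
    Dop m m (single k (C c)) = single (k - 1) (C (k * c)) := by
  simp [Dop, sum_single_index, zsmul_eq_mul]

theorem Xop_self_single (m : ℤ × ℤ) (k : ℤ) (a : MvPolynomial (NVar m) ℂ) :
    Xop m m (single k a) = single (k + 1) a := by
  simp [Xop, XmZ, mapDomain_single]

theorem smul_single_C (m : ℤ × ℤ) (k : ℤ) (a c : ℂ) :
    a • (single k (C c) : NN m) = single k (C (a * c)) := by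
  rw [smul_single, smul_eq_C_mul, ← C_mul]

/-- `E12(-m) x_m^k = q^{-m₁m₂} k (μ - (k - 1)) x_m^{k-1}`. -/
theorem E12N_neg_single_C (q μ : ℂ) (m : ℤ × ℤ) (k : ℤ) (c : ℂ) :
    E12N q μ m (-m) (single k (C c)) =
      single (k - 1) (C (q ^ (-(m.1 * m.2)) * (k * (μ - (k - 1))) * c)) := by
  have hexp : (-m).2 * m.1 + m.2 * (-m).1 + m.2 * m.1 = -(m.1 * m.2) := by
    simp only [Prod.fst_neg, Prod.snd_neg]
    ring
  have hexp' : -((-m).1 * (-m).2) = -(m.1 * m.2) := by simp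
  simp only [E12N, nvars_single_C, Finset.sum_singleton, neg_neg, hexp, hexp', neg_add_cancel,
    zero_add, Dop_self_single_C, Xop_self_single, smul_single_C, sub_add_cancel]
  rw [← single_sub, ← C_sub]
  congr 2
  push_cast
  ring

/-- `E12(−m)^i(x_m^{−1}) = (−1)^i q^{−i m₁m₂} i! (μ+2)⋯(μ+1+i) x_m^{−1−i}`. -/
theorem stmt10 (q μ : ℂ) (hq : q ≠ 0) (m : ℤ × ℤ) (i : ℕ) :
    (E12N q μ m (-m))^[i] (Finsupp.single (-1 : ℤ) 1) =
      ((-1 : ℂ) ^ i * q ^ (-((i : ℤ) * (m.1 * m.2))) * (i.factorial : ℂ) *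
          ∏ j ∈ Finset.range i, (μ + 2 + (j : ℂ))) •
        Finsupp.single (-1 - (i : ℤ)) (1 : MvPolynomial (NVar m) ℂ) := by
  rw [← C_1, smul_single_C]
  induction i with
  | zero => simp
  | succ i ih =>
    have hpow : q ^ (-(((i + 1 : ℕ) : ℤ) * (m.1 * m.2))) =
        q ^ (-((i : ℤ) * (m.1 * m.2))) * q ^ (-(m.1 * m.2)) := by
      rw [← zpow_add₀ hq]
      congr 1
      push_cast
      ring
    rw [Function.iterate_succ_apply', ih, E12N_neg_single_C, hpow, Finset.prod_range_succ,
      Nat.factorial_succ]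
    have hsub : (-1 - (i : ℤ)) - 1 = -1 - ((i + 1 : ℕ) : ℤ) := by
      push_cast
      ring
    rw [hsub]
    congr 2
    push_cast
    ring
end
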